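/- Fix β > 0 and a ≥ 0. For each integer n > 4β² set p_n = 1/2 + β/√n and q_n = 1/2 − β/√n. Then lim_{n→∞} ( (p_n − q_n)/(p_n q_n) ) · Σ_{k ≥ a√n, k even} (q_n/p_n)^k = exp(−4βa), where the sum is over even nonnegative integers k with k ≥ a√n. -/

import Mathlib

open Filter
open scoped Classical

lemma aux_sum (r y : ℝ) (h0 : 0 < r) (h1 : r < 1) :
    (∑' k : ℕ, if y ≤ (k : ℝ) ∧ Even k then r ^ k else 0)
      = r ^ (2 * ⌈y / 2⌉₊) * (1 - r ^ 2)⁻¹ := by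
  have hinj : Function.Injective (fun j : ℕ => 2 * ⌈y / 2⌉₊ + 2 * j) := by
    intro i j h
    simp only at h
    omega
  have hs : Function.support (fun k : ℕ => if y ≤ (k : ℝ) ∧ Even k then r ^ k else 0)
      ⊆ Set.range (fun j : ℕ => 2 * ⌈y / 2⌉₊ + 2 * j) := by
    intro k hk
    have hk' : y ≤ (k : ℝ) ∧ Even k := by
      by_contra h
      simp [h] at hk
    obtain ⟨hy, l, rfl⟩ := hk'
    have : ⌈y / 2⌉₊ ≤ l := by
      apply Nat.ceil_le.2
      push_cast at hy
      linarith
    exact ⟨l - ⌈y / 2⌉₊, by simp only; omega⟩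
  rw [← hinj.tsum_eq hs, ← tsum_geometric_of_lt_one (sq_nonneg r) (by nlinarith), ← tsum_mul_left]
  congr 1
  ext j
  have hc := Nat.le_ceil (y / 2)
  have hj : (0 : ℝ) ≤ j := Nat.cast_nonneg j
  rw [if_pos, pow_add, pow_mul r 2 j]
  refine ⟨by push_cast; linarith, ⟨⌈y / 2⌉₊ + j, by ring⟩⟩

lemma aux_log : Tendsto (fun x : ℝ => x⁻¹ * Real.log ((1 / 2 - x) / (1 / 2 + x)))
    (nhdsWithin 0 {0}ᶜ) (nhds (-4)) := by
  have h1 : HasDerivAt (fun x : ℝ => (1 / 2 - x) / (1 / 2 + x)) (-4) 0 := by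
    have := ((hasDerivAt_id (0 : ℝ)).const_sub (1 / 2)).fun_div
      ((hasDerivAt_id (0 : ℝ)).const_add (1 / 2)) (by norm_num)
    have e : ((-1 * (1 / 2 + id 0) - (1 / 2 - id 0) * 1) / (1 / 2 + id 0) ^ 2 : ℝ) = -4 := by
      norm_num
    rw [e] at this
    exact this
  have h2 := h1.log (by norm_num)
  have h3 := hasDerivAt_iff_tendsto_slope_zero.1 h2
  norm_num at h3
  norm_num
  exact h3

/-- With `p_n = 1/2 + β/√n` and `q_n = 1/2 - β/√n`,
`((p_n - q_n)/(p_n q_n)) · Σ_{k ≥ a√n, k even} (q_n/p_n)^k → exp(-4βa)`,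
the limit being taken over integers `n > 4β²`. -/
theorem geometric_tail_sum_limit (β a : ℝ) (hβ : 0 < β) (ha : 0 ≤ a) :
    Tendsto
      (fun n : ℕ =>
        (((1 / 2 + β / Real.sqrt n) - (1 / 2 - β / Real.sqrt n)) /
            ((1 / 2 + β / Real.sqrt n) * (1 / 2 - β / Real.sqrt n))) *
          ∑' k : ℕ,
            if a * Real.sqrt n ≤ (k : ℝ) ∧ Even k then
              ((1 / 2 - β / Real.sqrt n) / (1 / 2 + β / Real.sqrt n)) ^ k
            else 0)
      (atTop ⊓ 𝓟 {n : ℕ | 4 * β ^ 2 < (n : ℝ)})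
      (nhds (Real.exp (-(4 * β * a)))) := by
  have hs : Tendsto (fun n : ℕ => Real.sqrt n) atTop atTop :=
    Real.tendsto_sqrt_atTop.comp tendsto_natCast_atTop_atTop
  have hx : Tendsto (fun n : ℕ => β / Real.sqrt n) atTop (nhds 0) := hs.const_div_atTop β
  have hpos : ∀ᶠ n : ℕ in atTop, 0 < Real.sqrt n := hs.eventually_gt_atTop 0
  have hx' : Tendsto (fun n : ℕ => β / Real.sqrt n) atTop (nhdsWithin 0 {0}ᶜ) := by
    refine tendsto_nhdsWithin_iff.2 ⟨hx, ?_⟩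
    filter_upwards [hpos] with n hn
    exact (div_pos hβ hn).ne'
  have hl := aux_log.comp hx'
  have hm := (tendsto_nat_ceil_mul_div_atTop (R := ℝ) (a := a / 2) (by positivity)).comp hs
  have hE := ((hm.mul hl).const_mul (2 * β)).rexp
  have hq : Tendsto (fun n : ℕ => (1 / 2 + β / Real.sqrt n) / (1 / 2 - β / Real.sqrt n))
      atTop (nhds ((1 / 2 + 0) / (1 / 2 - 0))) :=
    (hx.const_add (1 / 2)).div (hx.const_sub (1 / 2)) (by norm_num)
  have hF := hq.mul hE
  have he : (1 / 2 + 0) / (1 / 2 - 0) * Real.exp (2 * β * (a / 2 * -4))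
      = Real.exp (-(4 * β * a)) := by
    norm_num
    ring
  rw [he] at hF
  refine Tendsto.mono_left (hF.congr' ?_) inf_le_left
  filter_upwards [hpos, hx.eventually_lt_const (show (0 : ℝ) < 1 / 2 by norm_num)] with n hn hn2
  have hxp : 0 < β / Real.sqrt n := div_pos hβ hn
  have hβx : β = (β / Real.sqrt n) * Real.sqrt n := by field_simp
  simp only [Function.comp]
  generalize hxe : β / Real.sqrt n = x at *
  have hr0 : 0 < (1 / 2 - x) / (1 / 2 + x) := div_pos (by linarith) (by linarith)
  have hr1 : (1 / 2 - x) / (1 / 2 + x) < 1 := (div_lt_one (by linarith)).2 (by linarith)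
  rw [aux_sum _ _ hr0 hr1]
  have hexp : Real.exp (2 * β * (↑⌈a / 2 * Real.sqrt n⌉₊ / Real.sqrt n *
      (x⁻¹ * Real.log ((1 / 2 - x) / (1 / 2 + x)))))
      = ((1 / 2 - x) / (1 / 2 + x)) ^ (2 * ⌈a * Real.sqrt n / 2⌉₊) := by
    rw [← Real.exp_log hr0, ← Real.exp_nat_mul, Real.exp_log hr0,
      show a * Real.sqrt n / 2 = a / 2 * Real.sqrt n by ring]
    congr 1
    push_cast
    generalize Real.log ((1 / 2 - x) / (1 / 2 + x)) = L
    rw [hβx]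
    field_simp
  rw [hexp]
  generalize ((1 / 2 - x) / (1 / 2 + x)) ^ (2 * ⌈a * Real.sqrt n / 2⌉₊) = P
  have e1 : 1 - ((1 / 2 - x) / (1 / 2 + x)) ^ 2 = 2 * x / (1 / 2 + x) ^ 2 := by
    have : (1 / 2 + x) ≠ 0 := by linarith
    rw [div_pow, eq_div_iff (by positivity), sub_mul, div_mul_cancel₀ _ (by positivity)]
    ring
  rw [e1, inv_div]
  have h1 : (1 / 2 + x) ≠ 0 := by linarith
  have h2 : (1 / 2 - x) ≠ 0 := by linarith
  rw [show (1 / 2 + x) - (1 / 2 - x) = 2 * x by ring]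
  generalize 1 / 2 + x = p at *
  generalize 1 / 2 - x = q at *
  field_simp
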